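/- arXiv:0905.0243 — 2 statements merged into one kernel-verified Lean document; each statement's English description precedes it below -/
import Mathlib

section
/- For every multi-index α = (α_1,…,α_s), the multiple series defining G_α(z) converges for every z ∈ ℂ ∖ {−1,−2,−3,…}, the resulting function is holomorphic on ℂ ∖ {−1,−2,−3,…} and extends to a meromorphic function on ℂ whose poles are contained in {−α_s, −α_s−1, −α_s−2, …}; moreover G_α(0) = 0. -/
open scoped BigOperators

/-- A multi-index: a nonempty finite sequence of positive integers. -/
def MIdx (α : List ℕ) : Prop := α ≠ [] ∧ ∀ a ∈ α, 1 ≤ a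

/-- The set `S_m(α) = {α₁, α₁+α₂, …, α₁+⋯+α_{s-1}} ⊆ {1,…,m-1}` of proper partial sums. -/
def boundarySet (α : List ℕ) : Finset ℕ :=
  (((List.scanl (· + ·) 0 α).drop 1).dropLast).toFinset

def diffAux : ℕ → List ℕ → List ℕ
  | _, [] => []
  | p, a :: t => (a - p) :: diffAux a t

/-- The dual multi-index `α*`. -/
def dualIdx (α : List ℕ) : List ℕ :=
  diffAux 0 ((insert α.sum (Finset.Icc 1 (α.sum - 1) \ boundarySet α)).sort (· ≤ ·))

/-- The finite multiple harmonic sum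
`S_α(n) = Σ_{n > n₁ ≥ ⋯ ≥ n_s ≥ 0} 1/((n₁+1)^{α₁} ⋯ (n_s+1)^{α_s})`. -/
noncomputable def hsum : List ℕ → ℕ → ℝ
  | [], _ => 1
  | a :: t, n => ∑ m ∈ Finset.range n, (1 / ((m : ℝ) + 1) ^ a) * hsum t (m + 1)

open Classical in
/-- The summand of the multiple series `G_α(z)`, indexed by tuples
`v : Fin |α| → ℕ`; it vanishes unless all `v j` are positive and the chain of
comparisons dictated by `α` holds (strict within blocks, weak between blocks). -/
noncomputable def Gterm (α : List ℕ) (z : ℂ) (v : Fin α.sum → ℕ) : ℂ :=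
  if (∀ j, 0 < v j) ∧ (∀ j k : Fin α.sum, (k : ℕ) = (j : ℕ) + 1 →
        (if (k : ℕ) ∈ boundarySet α then v k ≤ v j else v k < v j))
  then ∏ j : Fin α.sum, (if (j : ℕ) = 0 then (1 / (v j : ℂ) - 1 / ((v j : ℂ) + z))
             else if (j : ℕ) ∈ boundarySet α then 1 / ((v j : ℂ) + z)
             else 1 / (v j : ℂ))
  else 0

/-- The multiple series `G_α(z)`. -/
noncomputable def Gfun (α : List ℕ) (z : ℂ) : ℂ := ∑' v : Fin α.sum → ℕ, Gterm α z v

/-- `⁻α` : remove 1 from the first entry. -/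
def lminus (α : List ℕ) : List ℕ :=
  match α with
  | [] => []
  | a :: t => if 2 ≤ a then (a - 1) :: t else t

/-- `α⁻` : remove 1 from the last entry. -/
def rminus (α : List ℕ) : List ℕ :=
  if 2 ≤ α.getLastD 0 then α.dropLast ++ [α.getLastD 0 - 1] else α.dropLast

/-- The difference operator `(Δa)(n) = a(n) - a(n+1)`. -/
def delOp (a : ℕ → ℂ) : ℕ → ℂ := fun n => a n - a (n + 1)

/-- The inversion operator `(∇a)(n) = (Δⁿa)(0)`. -/
def nablaOp (a : ℕ → ℂ) : ℕ → ℂ := fun n => delOp^[n] a 0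

/-- The generalized binomial coefficient `z(z-1)⋯(z-n+1)/n!`. -/
noncomputable def cbinom (z : ℂ) (n : ℕ) : ℂ :=
  (∏ i ∈ Finset.range n, (z - (i : ℂ))) / (n.factorial : ℂ)

/-- The Newton series with coefficients `c` converges at `z` to `L`. -/
def NewtonSeriesTo (c : ℕ → ℂ) (z L : ℂ) : Prop :=
  Filter.Tendsto (fun N => ∑ n ∈ Finset.range N, (-1 : ℂ) ^ n * c n * cbinom z n)
    Filter.atTop (nhds L)

/-- The Newton series interpolating the sequence `a` converges at `z` to `L`. -/
def NewtonSumsTo (a : ℕ → ℂ) (z L : ℂ) : Prop := NewtonSeriesTo (nablaOp a) z L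

open Classical in
/-- `ζ_α(μ)` : the nested sum over tuples patterned on `α` with exponents `μ`. -/
noncomputable def zetaIdx (α : List ℕ) (μ : List ℕ) : ℝ :=
  ∑' v : Fin α.sum → ℕ,
    if (∀ j, 0 < v j) ∧ (∀ j k : Fin α.sum, (k : ℕ) = (j : ℕ) + 1 →
          (if (k : ℕ) ∈ boundarySet α then v k ≤ v j else v k < v j))
    then ∏ j : Fin α.sum, (1 : ℝ) / (v j : ℝ) ^ (μ.getD (j : ℕ) 1)
    else 0

/-- The multiple zeta value `ζ(μ) = ζ_{(p)}(μ)`. -/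
noncomputable def MZV (μ : List ℕ) : ℝ := zetaIdx [μ.length] μ

/-- `⁺μ` : add 1 to the first entry. -/
def mplus : List ℕ → List ℕ
  | [] => []
  | a :: t => (a + 1) :: t

/-- `ζ` extended ℚ-linearly to the vector space with basis the multi-indices. -/
noncomputable def zetaLin (v : List ℕ →₀ ℚ) : ℝ := v.sum fun μ c => (c : ℝ) * MZV μ

/-- `ζ⁺(μ) = ζ(⁺μ)`, extended ℚ-linearly. -/
noncomputable def zetaPlusLin (v : List ℕ →₀ ℚ) : ℝ := v.sum fun μ c => (c : ℝ) * MZV (mplus μ)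

/-- All ways of splitting a list into consecutive nonempty blocks. -/
def splits : List ℕ → List (List (List ℕ))
  | [] => [[]]
  | a :: t =>
      (splits t).map (fun c => [a] :: c) ++
      (splits t).filterMap (fun c =>
        match c with
        | [] => none
        | b :: r => some ((a :: b) :: r))

/-- `d(α) = Σ_{β ≤ α} β`, the sum over all coarsenings of `α`. -/
noncomputable def dmap (α : List ℕ) : List ℕ →₀ ℚ :=
  ((splits α).map fun c => Finsupp.single (c.map List.sum) (1 : ℚ)).sum

/-- All compositions of `n` into positive parts. -/
def comps : ℕ → List (List ℕ)
  | 0 => [[]]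
  | n + 1 => (List.range (n + 1)).flatMap fun j => (comps (n - j)).map fun c => (j + 1) :: c

/-- All refinements of `α`. -/
def refts : List ℕ → List (List ℕ)
  | [] => [[]]
  | a :: t => (comps a).flatMap fun c => (refts t).map fun β => c ++ β

/-- `u(α) = Σ_{β ≥ α} β`, the sum over all refinements of `α`. -/
noncomputable def umap (α : List ℕ) : List ℕ →₀ ℚ :=
  ((refts α).map fun β => Finsupp.single β (1 : ℚ)).sum

/-- The harmonic (quasi-shuffle) product on multi-indices, with values in the
ℚ-vector space with basis the multi-indices. -/
noncomputable def hprod : List ℕ → List ℕ → (List ℕ →₀ ℚ)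
  | [], u => Finsupp.single u 1
  | a :: s, [] => Finsupp.single (a :: s) 1
  | a :: s, b :: t =>
      Finsupp.mapDomain (List.cons a) (hprod s (b :: t)) +
      Finsupp.mapDomain (List.cons b) (hprod (a :: s) t) +
      Finsupp.mapDomain (List.cons (a + b)) (hprod s t)
  termination_by l₁ l₂ => l₁.length + l₂.length

/-- `α ⊛ β = (α₁+β₁) # (⁻α ∗ ⁻β)`. -/
noncomputable def circAst : List ℕ → List ℕ → (List ℕ →₀ ℚ)
  | a :: s, b :: t =>
      Finsupp.mapDomain (List.cons (a + b)) (hprod (lminus (a :: s)) (lminus (b :: t)))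
  | _, _ => 0

/-- `⊛` extended linearly in the first argument. -/
noncomputable def circAstLin (v : List ℕ →₀ ℚ) (β : List ℕ) : List ℕ →₀ ℚ :=
  v.sum fun γ c => c • circAst γ β

/-- The exponent list `(k₁+1,1,…,1, k₂+1,1,…,1, …, k_s+1,1,…,1)`, the `i`-th block
having length `α_i`. -/
def blockList (α : List ℕ) (ks : Fin α.length → ℕ) : List ℕ :=
  (List.ofFn fun i => (ks i + 1) :: List.replicate (α.get i - 1) 1).flatten

/-- `Q_r(n₁,…,n_r; z) = 1/((n₁+z)⋯(n_r+z))`, with `Q_0 = 1`. -/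
noncomputable def Qprod (l : List ℕ) (z : ℂ) : ℂ := (l.map fun n => 1 / ((n : ℂ) + z)).prod

/-- `R_r(n₁,…,n_r) = 1/(n₁⋯n_r)`, with `R_0 = 1`. -/
noncomputable def Rprod (l : List ℕ) : ℂ := (l.map fun n => 1 / (n : ℂ)).prod

/-- A block of `len` variables of factor type `fTy` (1 = Q-type, 2 = R-type); the first
carries the comparison `joinWeak` to the previous variable, subsequent ones carry the
block-internal comparison (weak inside Q-blocks, strict inside R-blocks). -/
def blockPart (fTy : ℕ) (joinWeak : Bool) : ℕ → List (ℕ × Bool)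
  | 0 => []
  | m + 1 => (fTy, joinWeak) :: List.replicate m (fTy, fTy == 1)

/-- The word of (factor type, comparison) pairs describing a `Φ`-sum: `qr` is the
weakness of the `□'` joins (Q-block to R-block) and `rq` that of the `□` joins
(R-block to next Q-block). -/
def mkWord (qr rq : Bool) (gs : List (ℕ × ℕ)) : List (ℕ × Bool) :=
  gs.flatMap fun g => blockPart 1 rq g.1 ++ blockPart 2 qr g.2

/-- The word of a `Φ`-sum: the very first factor is of `Q̃`-type (coded 0). -/
def phiWord (qr rq : Bool) (gs : List (ℕ × ℕ)) : List (ℕ × Bool) :=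
  match mkWord qr rq gs with
  | [] => []
  | (_, b) :: t => (0, b) :: t

open Classical in
/-- The nested sum `Φ_z` attached to a word `w` of (factor type, comparison) pairs:
factor type 0 gives `1/n - 1/(n+z)`, type 1 gives `1/(n+z)`, type 2 gives `1/n`;
comparison `true` means `≥`, `false` means `>`. -/
noncomputable def PhiSum (w : List (ℕ × Bool)) (z : ℂ) : ℂ :=
  ∑' v : Fin w.length → ℕ,
    if (∀ j, 0 < v j) ∧ (∀ j k : Fin w.length, (k : ℕ) = (j : ℕ) + 1 →
          (if (w.get k).2 then v k ≤ v j else v k < v j))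
    then ∏ j : Fin w.length, (if (w.get j).1 = 0 then (1 / (v j : ℂ) - 1 / ((v j : ℂ) + z))
               else if (w.get j).1 = 1 then 1 / ((v j : ℂ) + z)
               else 1 / (v j : ℂ))
    else 0

lemma summable_fin_prod (m : ℕ) (f : ℕ → ℝ) (hf : Summable f) (h0 : ∀ n, 0 ≤ f n) :
    Summable (fun v : Fin m → ℕ => ∏ j, f (v j)) := by
  classical
  refine summable_of_sum_le (c := ∏ _j : Fin m, ∑' n, f n)
    (fun v => Finset.prod_nonneg fun j _ => h0 _) ?_
  intro u
  have hsub : u ⊆ Fintype.piFinset (fun j => u.image (fun v => v j)) := by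
    intro v hv
    rw [Fintype.mem_piFinset]
    intro j
    exact Finset.mem_image_of_mem (fun v => v j) hv
  calc ∑ v ∈ u, ∏ j, f (v j)
      ≤ ∑ v ∈ Fintype.piFinset (fun j => u.image (fun v => v j)), ∏ j, f (v j) :=
        Finset.sum_le_sum_of_subset_of_nonneg hsub
          (fun v _ _ => Finset.prod_nonneg fun j _ => h0 _)
    _ = ∏ j : Fin m, ∑ n ∈ u.image (fun v => v j), f n := by
        rw [Finset.prod_univ_sum]
    _ ≤ ∏ _j : Fin m, ∑' n, f n := by
        refine Finset.prod_le_prod (fun j _ => Finset.sum_nonneg fun n _ => h0 n) ?_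
        intro j _
        exact hf.sum_le_tsum _ (fun n _ => h0 n)

open Classical in
lemma summable_chain (m : ℕ) (j0 : Fin m) (P : (Fin m → ℕ) → Prop)
    (hP : ∀ v, P v → (∀ j, 0 < v j) ∧ ∀ j, v j ≤ v j0) :
    Summable (fun v : Fin m → ℕ =>
      if P v then (1 / (v j0 : ℝ)) * ∏ j, (1 / (v j : ℝ)) else 0) := by
  have hm : 0 < m := j0.pos
  have hmR : (0 : ℝ) < m := by exact_mod_cast hm
  have hs : Summable (fun n : ℕ => 1 / (n : ℝ) ^ (1 + 1 / (m : ℝ))) := by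
    apply Real.summable_one_div_nat_rpow.2
    have : 0 < 1 / (m : ℝ) := by positivity
    linarith
  refine Summable.of_nonneg_of_le ?_ ?_
    (summable_fin_prod m _ hs (fun n => by positivity))
  · intro v
    split_ifs
    · positivity
    · exact le_rfl
  · intro v
    split_ifs with h
    · obtain ⟨h1, h2⟩ := hP v h
      have e1 : (1 / (v j0 : ℝ)) = ∏ _j : Fin m, (1 / (v j0 : ℝ) ^ (1 / (m : ℝ))) := by
        rw [Finset.prod_const, Finset.card_univ, Fintype.card_fin, div_pow, one_pow,
          ← Real.rpow_mul_natCast (by positivity), one_div_mul_cancel hmR.ne', Real.rpow_one]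
      rw [e1, ← Finset.prod_mul_distrib]
      refine Finset.prod_le_prod (fun j _ => by positivity) ?_
      intro j _
      have hj : (0 : ℝ) < v j := by exact_mod_cast h1 j
      have hj' : (v j : ℝ) ≤ v j0 := by exact_mod_cast h2 j
      rw [add_comm, Real.rpow_add hj, Real.rpow_one, ← one_div_mul_one_div]
      gcongr
    · positivity

open Classical in
/-- Generic holomorphy of the nested series. -/
lemma chain_series (m : ℕ) (j0 : Fin m) (P : (Fin m → ℕ) → Prop)
    (hP : ∀ v, P v → (∀ j, 0 < v j) ∧ ∀ j, v j ≤ v j0)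
    (f : Fin m → ℕ → ℂ → ℂ) (U : Set ℂ) (hU : IsOpen U) (C : ℝ) 
    (hd : ∀ j n, 0 < n → DifferentiableOn ℂ (f j n) U)
    (hb : ∀ j n, j ≠ j0 → 0 < n → ∀ z ∈ U, ‖f j n z‖ ≤ C * (1 / (n : ℝ)))
    (hb0 : ∀ n, 0 < n → ∀ z ∈ U, ‖f j0 n z‖ ≤ C * (1 / (n : ℝ)) * (1 / (n : ℝ))) :
    (∀ z ∈ U, Summable (fun v : Fin m → ℕ => if P v then ∏ j, f j (v j) z else 0)) ∧
    DifferentiableOn ℂ (fun z => ∑' v : Fin m → ℕ, if P v then ∏ j, f j (v j) z else 0) U := by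
  have hs := (summable_chain m j0 P hP).mul_left (C ^ m)
  have hle : ∀ (v : Fin m → ℕ) (z : ℂ), z ∈ U →
      ‖(if P v then ∏ j, f j (v j) z else 0)‖ ≤
      C ^ m * (if P v then (1 / (v j0 : ℝ)) * ∏ j, (1 / (v j : ℝ)) else 0) := by
    intro v z hz
    split_ifs with h
    · obtain ⟨h1, h2⟩ := hP v h
      have e : C ^ m * ((1 / (v j0 : ℝ)) * ∏ j, (1 / (v j : ℝ))) =
          ∏ j, (C * (1 / (v j : ℝ)) * (if j = j0 then (1 / (v j0 : ℝ)) else 1)) := by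
        rw [Finset.prod_mul_distrib, Finset.prod_mul_distrib, Finset.prod_const,
          Finset.card_univ, Fintype.card_fin, Finset.prod_ite_eq' Finset.univ j0]
        simp only [Finset.mem_univ, if_true]
        ring
      rw [e, norm_prod]
      refine Finset.prod_le_prod (fun j _ => norm_nonneg _) ?_
      intro j _
      split_ifs with hj
      · subst hj
        exact hb0 _ (h1 _) z hz
      · rw [mul_one]
        exact hb j _ hj (h1 j) z hz
    · simp
  refine ⟨fun z hz => Summable.of_norm_bounded hs (fun v => hle v z hz), ?_⟩
  refine Complex.differentiableOn_tsum_of_summable_norm hs ?_ hU hle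
  intro v
  by_cases h : P v
  · simp only [h, if_true]
    refine DifferentiableOn.fun_finsetProd ?_
    intro j _
    exact hd j _ ((hP v h).1 j)
  · simp only [h, if_false]
    exact differentiableOn_const _

lemma local_inv_bound (z0 : ℂ) : ∃ r C : ℝ, 0 < r ∧ r ≤ 1 ∧ 0 < C ∧
    ∀ n : ℕ, 0 < n → (n : ℂ) + z0 ≠ 0 → ∀ z ∈ Metric.ball z0 r,
      (n : ℂ) + z ≠ 0 ∧ ‖1 / ((n : ℂ) + z)‖ ≤ C * (1 / (n : ℝ)) := by
  have ht : Filter.Tendsto (fun n : ℕ => (n : ℂ) / ((n : ℂ) + z0)) Filter.atTop (nhds 1) :=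
    tendsto_natCast_div_add_atTop z0
  obtain ⟨M0, hM0⟩ := (Metric.isBounded_range_of_tendsto _ ht).exists_norm_le
  set M := max M0 1 with hM
  have hM1 : 1 ≤ M := le_max_right _ _
  have hMpos : 0 < M := by linarith
  refine ⟨1 / (2 * M), 2 * M, by positivity, ?_, by positivity, ?_⟩
  · rw [div_le_one (by positivity)]; linarith
  · intro n hn hne z hz
    have hnR : (1 : ℝ) ≤ n := by exact_mod_cast hn
    have h1 : ‖(n : ℂ) / ((n : ℂ) + z0)‖ ≤ M := (hM0 _ ⟨n, rfl⟩).trans (le_max_left _ _)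
    have hpos : 0 < ‖(n : ℂ) + z0‖ := norm_pos_iff.2 hne
    rw [norm_div, Complex.norm_natCast, div_le_iff₀ hpos] at h1
    rw [mem_ball_iff_norm] at hz
    have h2 : ‖(n : ℂ) + z0‖ ≤ ‖(n : ℂ) + z‖ + ‖z - z0‖ := by
      have : (n : ℂ) + z0 = ((n : ℂ) + z) - (z - z0) := by ring
      rw [this]; exact norm_sub_le _ _
    have h3 : M * ‖z - z0‖ < 1 / 2 := by
      rw [lt_div_iff₀ (by positivity)] at hz
      linarith
    have h4 : (n : ℝ) ≤ 2 * M * ‖(n : ℂ) + z‖ := by nlinarith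
    have h5 : 0 < ‖(n : ℂ) + z‖ := by
      by_contra h
      have : ‖(n : ℂ) + z‖ = 0 := le_antisymm (not_lt.1 h) (norm_nonneg _)
      rw [this] at h4; linarith
    refine ⟨norm_pos_iff.1 h5, ?_⟩
    rw [norm_div, norm_one, mul_one_div, div_le_div_iff₀ h5 (by linarith)]
    linarith

lemma boundary_le (α : List ℕ) (b : ℕ) (hb : b ∈ boundarySet α) :
    b + α.getLastD 0 ≤ α.sum := by
  rcases List.eq_nil_or_concat α with rfl | ⟨β, L, rfl⟩
  · simp [boundarySet] at hb
  · have key : ∀ (β : List ℕ) (s b : ℕ), b ∈ List.scanl (· + ·) s β → b ≤ s + β.sum := by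
      intro β
      induction β with
      | nil => intro s b h; simp at h; simp [h]
      | cons a t ih =>
        intro s b h
        rw [List.scanl_cons, List.mem_cons] at h
        rcases h with h | h
        · simp; omega
        · have := ih _ _ h
          simp; omega
    have hb' : b ∈ List.scanl (· + ·) 0 β := by
      simp only [boundarySet, List.mem_toFinset, List.drop_one] at hb
      have h2 : ∀ l : List ℕ, b ∈ l.tail.dropLast → b ∈ l.dropLast := by
        intro l hl
        rw [← List.tail_dropLast] at hl
        exact List.mem_of_mem_tail hl
      have := h2 _ hb
      have hsc : ∀ (β : List ℕ) (s : ℕ),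
          (List.scanl (· + ·) s (β ++ [L])).dropLast = List.scanl (· + ·) s β := by
        intro β
        induction β with
        | nil => intro s; simp
        | cons a t ih =>
          intro s
          have hne : List.scanl (· + ·) (s + a) (t ++ [L]) ≠ [] := by
            intro h
            simpa using congrArg List.length h
          rw [List.cons_append, List.scanl_cons, List.scanl_cons,
            List.dropLast_cons_of_ne_nil hne, ih]
      rw [← hsc β 0]
      simpa using this
    have := key _ _ _ hb'
    simp
    omega

/-- The chain condition in `Gterm`. -/
def GChain (α : List ℕ) (v : Fin α.sum → ℕ) : Prop :=
  (∀ j, 0 < v j) ∧ (∀ j k : Fin α.sum, (k : ℕ) = (j : ℕ) + 1 →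
        (if (k : ℕ) ∈ boundarySet α then v k ≤ v j else v k < v j))

lemma GChain.anti {α : List ℕ} {v : Fin α.sum → ℕ} (h : GChain α v) :
    ∀ (d : ℕ) (j k : Fin α.sum), (k : ℕ) = j + d → v k ≤ v j := by
  intro d
  induction d with
  | zero => intro j k e; rw [show k = j from Fin.ext (by omega)]
  | succ d ih =>
    intro j k e
    have hk := k.2
    let i : Fin α.sum := ⟨j + d, by omega⟩
    have h1 : v i ≤ v j := ih j i rfl
    have h2 := h.2 i k (by simp only [i]; omega)
    split_ifs at h2 <;> omega

lemma GChain.ge_last {α : List ℕ} {v : Fin α.sum → ℕ} (h : GChain α v) (j : Fin α.sum)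
    (hj : (j : ℕ) + α.getLastD 0 ≤ α.sum) : α.getLastD 0 ≤ v j := by
  have key : ∀ (d : ℕ) (k : Fin α.sum), α.sum ≤ k + α.getLastD 0 → (k : ℕ) + d + 1 = α.sum →
      d + 1 ≤ v k := by
    intro d
    induction d with
    | zero => intro k _ _; exact h.1 k
    | succ d ih =>
      intro k h1 h2
      let i : Fin α.sum := ⟨k + 1, by omega⟩
      have h3 := ih i (by simp only [i]; omega) (by simp only [i]; omega)
      have h4 := h.2 k i rfl
      split_ifs at h4 with hb
      · have := boundary_le α _ hb
        simp only [i] at this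
        omega
      · omega
  rcases Nat.eq_zero_or_pos (α.getLastD 0) with h0 | h0
  · omega
  · have := j.2
    let B : Fin α.sum := ⟨α.sum - α.getLastD 0, by omega⟩
    have h1 := key (α.getLastD 0 - 1) B (by simp only [B]; omega) (by simp only [B]; omega)
    have h2 := h.anti (α.sum - α.getLastD 0 - j) j B (by simp only [B]; omega)
    omega

lemma getLastD_le_sum (α : List ℕ) : α.getLastD 0 ≤ α.sum := by
  rcases List.eq_nil_or_concat α with rfl | ⟨β, L, rfl⟩ <;> simp

/-- modified factor -/
noncomputable def Gfac (α : List ℕ) (g : ℕ → ℂ → ℂ) (e : ℂ → ℂ) (j : Fin α.sum) (n : ℕ)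
    (z : ℂ) : ℂ :=
  if (j : ℕ) = 0 then z / (n : ℂ) * g n z
  else if (j : ℕ) ∈ boundarySet α then g n z else e z / (n : ℂ)

open Classical in
lemma Gmod (α : List ℕ) (hm : 0 < α.sum) (g : ℕ → ℂ → ℂ) (e : ℂ → ℂ) (U : Set ℂ)
    (hU : IsOpen U) (C : ℝ) 
    (hg : ∀ n, 0 < n → DifferentiableOn ℂ (g n) U) (he : DifferentiableOn ℂ e U)
    (hgb : ∀ n, 0 < n → ∀ z ∈ U, ‖g n z‖ ≤ C * (1 / (n : ℝ)))
    (heb : ∀ z ∈ U, ‖e z‖ ≤ C) (hzb : ∀ z ∈ U, ‖z‖ ≤ C) :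
    (∀ z ∈ U, Summable (fun v : Fin α.sum → ℕ =>
      if GChain α v then ∏ j, Gfac α g e j (v j) z else 0)) ∧
    DifferentiableOn ℂ (fun z => ∑' v : Fin α.sum → ℕ,
      if GChain α v then ∏ j, Gfac α g e j (v j) z else 0) U := by
  by_cases hne : U.Nonempty
  swap
  · rw [Set.not_nonempty_iff_eq_empty.1 hne]
    exact ⟨fun z hz => absurd hz (Set.notMem_empty z), differentiableOn_empty⟩
  have hC : 0 ≤ C := by
    obtain ⟨z, hz⟩ := hne
    exact (norm_nonneg _).trans (hzb z hz)
  refine chain_series α.sum ⟨0, hm⟩ (GChain α) ?_ (Gfac α g e) U hU (max C (C * C)) ?_ ?_ ?_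
  · intro v hv
    exact ⟨hv.1, fun j => hv.anti j _ j (by simp)⟩
  · intro j n hn
    unfold Gfac
    split_ifs
    · exact (differentiableOn_id.div_const _).mul (hg n hn)
    · exact hg n hn
    · exact he.div_const _
  · intro j n hj hn z hz
    have hj' : (j : ℕ) ≠ 0 := fun h => hj (Fin.ext h)
    have hmx : C * (1 / (n : ℝ)) ≤ max C (C * C) * (1 / (n : ℝ)) := by
      gcongr; exact le_max_left _ _
    unfold Gfac
    rw [if_neg hj']
    split_ifs
    · exact (hgb n hn z hz).trans hmx
    · refine le_trans ?_ hmx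
      rw [norm_div, Complex.norm_natCast, mul_one_div]
      gcongr
      exact heb z hz
  · intro n hn z hz
    have hmx : C * C * (1 / (n : ℝ)) * (1 / (n : ℝ)) ≤
        max C (C * C) * (1 / (n : ℝ)) * (1 / (n : ℝ)) := by
      gcongr; exact le_max_right _ _
    refine le_trans ?_ hmx
    unfold Gfac
    rw [if_pos rfl, norm_mul, norm_div, Complex.norm_natCast]
    calc ‖z‖ / (n : ℝ) * ‖g n z‖ ≤ C / (n : ℝ) * (C * (1 / (n : ℝ))) := by
          gcongr
          · exact hzb z hz
          · exact hgb n hn z hz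
      _ = _ := by ring

open Classical in
lemma Gmod_eq (α : List ℕ) (g : ℕ → ℂ → ℂ) (e : ℂ → ℂ) (z : ℂ)
    (h : ∀ n : ℕ, 0 < n → α.getLastD 0 ≤ n → (n : ℂ) + z ≠ 0 ∧ g n z = e z / ((n : ℂ) + z))
    (v : Fin α.sum → ℕ) :
    (if GChain α v then ∏ j, Gfac α g e j (v j) z else 0) = e z ^ α.sum * Gterm α z v := by
  unfold Gterm
  by_cases hv : GChain α v
  · rw [if_pos hv, if_pos (show _ ∧ _ from hv)]
    have : e z ^ α.sum = ∏ _j : Fin α.sum, e z := by simp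
    rw [this, ← Finset.prod_mul_distrib]
    refine Finset.prod_congr rfl ?_
    intro j _
    have hpos : ((v j : ℕ) : ℂ) ≠ 0 := by exact_mod_cast (hv.1 j).ne'
    unfold Gfac
    split_ifs with h0 h1
    · obtain ⟨a, b⟩ := h (v j) (hv.1 j) (hv.ge_last j (by
        rw [h0, zero_add]; exact getLastD_le_sum α))
      rw [b]
      field_simp
      ring
    · obtain ⟨a, b⟩ := h (v j) (hv.1 j) (hv.ge_last j (boundary_le α _ h1))
      rw [b, mul_one_div]
    · rw [mul_one_div]
  · rw [if_neg hv, if_neg (show ¬ (_ ∧ _) from hv), mul_zero]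

lemma G_good (α : List ℕ) (hm : 0 < α.sum) (z0 : ℂ)
    (h0 : ∀ n : ℕ, 0 < n → α.getLastD 0 ≤ n → (n : ℂ) + z0 ≠ 0) :
    Summable (Gterm α z0) ∧ AnalyticAt ℂ (Gfun α) z0 := by
  classical
  obtain ⟨r, C, hr, hr1, hC, hb⟩ := local_inv_bound z0
  let g : ℕ → ℂ → ℂ := fun n z => if α.getLastD 0 ≤ n then 1 / ((n : ℂ) + z) else 0
  have side1 : ∀ n, 0 < n → DifferentiableOn ℂ (g n) (Metric.ball z0 r) := by
    intro n hn
    by_cases hL : α.getLastD 0 ≤ n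
    · simp only [g, if_pos hL]
      exact (differentiableOn_const _).div ((differentiableOn_const _).add differentiableOn_id)
        (fun z hz => (hb n hn (h0 n hn hL) z hz).1)
    · simp only [g, if_neg hL]
      exact differentiableOn_const _
  have side2 : ∀ n, 0 < n → ∀ z ∈ Metric.ball z0 r, ‖g n z‖ ≤ max C (‖z0‖ + 1) * (1 / (n : ℝ)) := by
    intro n hn z hz
    by_cases hL : α.getLastD 0 ≤ n
    · simp only [g, if_pos hL]
      refine (hb n hn (h0 n hn hL) z hz).2.trans ?_
      gcongr
      exact le_max_left _ _
    · simp only [g, if_neg hL, norm_zero]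
      positivity
  have side3 : ∀ z ∈ Metric.ball z0 r, ‖(1 : ℂ)‖ ≤ max C (‖z0‖ + 1) := by
    intro z hz
    rw [norm_one]
    exact le_trans (by linarith [norm_nonneg z0]) (le_max_right _ _)
  have side4 : ∀ z ∈ Metric.ball z0 r, ‖z‖ ≤ max C (‖z0‖ + 1) := by
    intro z hz
    rw [mem_ball_iff_norm] at hz
    refine le_trans ?_ (le_max_right _ _)
    have := norm_le_norm_add_norm_sub' z z0
    linarith
  obtain ⟨hs, hd⟩ := Gmod α hm g (fun _ => 1) (Metric.ball z0 r) Metric.isOpen_ball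
    (max C (‖z0‖ + 1)) side1 (differentiableOn_const _) side2 side3 side4
  have heq : ∀ z ∈ Metric.ball z0 r, ∀ v, _ = _ := fun z hz =>
    Gmod_eq α g (fun _ => 1) z (fun n hn hL =>
      ⟨(hb n hn (h0 n hn hL) z hz).1, by simp only [g, if_pos hL]⟩)
  simp only [one_pow, one_mul] at heq
  refine ⟨?_, ?_⟩
  · have := hs z0 (Metric.mem_ball_self hr)
    rwa [funext (heq z0 (Metric.mem_ball_self hr))] at this
  · have h1 := hd.analyticAt (Metric.ball_mem_nhds z0 hr)
    refine h1.congr ?_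
    filter_upwards [Metric.ball_mem_nhds z0 hr] with z hz
    exact tsum_congr (heq z hz)

lemma G_mero (α : List ℕ) (hm : 0 < α.sum) (z0 : ℂ) : MeromorphicAt (Gfun α) z0 := by
  classical
  obtain ⟨r, C, hr, hr1, hC, hb⟩ := local_inv_bound z0
  let g : ℕ → ℂ → ℂ := fun n z => if (n : ℂ) + z0 = 0 then 1 else (z - z0) / ((n : ℂ) + z)
  have side1 : ∀ n, 0 < n → DifferentiableOn ℂ (g n) (Metric.ball z0 r) := by
    intro n hn
    by_cases hL : (n : ℂ) + z0 = 0
    · simp only [g, if_pos hL]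
      exact differentiableOn_const _
    · simp only [g, if_neg hL]
      exact (differentiableOn_id.sub (differentiableOn_const _)).div
        ((differentiableOn_const _).add differentiableOn_id)
        (fun z hz => (hb n hn hL z hz).1)
  have side2 : ∀ n, 0 < n → ∀ z ∈ Metric.ball z0 r, ‖g n z‖ ≤ max C (‖z0‖ + 1) * (1 / (n : ℝ)) := by
    intro n hn z hz
    have hnR : (0 : ℝ) < n := by exact_mod_cast hn
    by_cases hL : (n : ℂ) + z0 = 0
    · simp only [g, if_pos hL, norm_one]
      have e : z0 = -(n : ℂ) := by linear_combination hL
      have : ‖z0‖ = n := by rw [e, norm_neg, Complex.norm_natCast]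
      rw [mul_one_div, le_div_iff₀ hnR, one_mul]
      exact le_trans (by linarith) (le_max_right _ _)
    · simp only [g, if_neg hL]
      rw [mem_ball_iff_norm] at hz
      have h1 := (hb n hn hL z (by rwa [mem_ball_iff_norm])).2
      rw [div_eq_mul_one_div, norm_mul]
      calc ‖z - z0‖ * ‖1 / ((n : ℂ) + z)‖ ≤ 1 * (C * (1 / (n : ℝ))) := by
            gcongr
            linarith
        _ ≤ _ := by
            rw [one_mul]; gcongr; exact le_max_left _ _
  have side3 : ∀ z ∈ Metric.ball z0 r, ‖z - z0‖ ≤ max C (‖z0‖ + 1) := by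
    intro z hz
    rw [mem_ball_iff_norm] at hz
    exact le_trans (by linarith [norm_nonneg z0]) (le_max_right _ _)
  have side4 : ∀ z ∈ Metric.ball z0 r, ‖z‖ ≤ max C (‖z0‖ + 1) := by
    intro z hz
    rw [mem_ball_iff_norm] at hz
    refine le_trans ?_ (le_max_right _ _)
    have := norm_le_norm_add_norm_sub' z z0
    linarith
  obtain ⟨hs, hd⟩ := Gmod α hm g (fun z => z - z0) (Metric.ball z0 r) Metric.isOpen_ball
    (max C (‖z0‖ + 1)) side1 (differentiableOn_id.sub (differentiableOn_const _)) side2 side3 side4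
  have heq : ∀ z ∈ Metric.ball z0 r, z ≠ z0 → ∀ v, _ = _ := fun z hz hne =>
    Gmod_eq α g (fun z => z - z0) z (fun n hn hL => by
      by_cases hn0 : (n : ℂ) + z0 = 0
      · have e : (n : ℂ) + z = z - z0 := by linear_combination hn0
        have := sub_ne_zero.2 hne
        simp only [g, if_pos hn0, e, ne_eq, this, not_false_eq_true, true_and]
        rw [div_self this]
      · exact ⟨(hb n hn hn0 z hz).1, by simp only [g, if_neg hn0]⟩)
  have h1 := (hd.analyticAt (Metric.ball_mem_nhds z0 hr)).meromorphicAt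
  have h2 : MeromorphicAt (fun z : ℂ => (z - z0) ^ α.sum) z0 := by fun_prop
  refine (h1.div h2).congr ?_
  have hball : Metric.ball z0 r ∈ nhdsWithin z0 {z0}ᶜ :=
    mem_nhdsWithin_of_mem_nhds (Metric.ball_mem_nhds z0 hr)
  filter_upwards [hball, self_mem_nhdsWithin] with z hz hne
  have hne' : z ≠ z0 := hne
  have hp : (z - z0) ^ α.sum ≠ 0 := pow_ne_zero _ (sub_ne_zero.2 hne')
  simp only [Pi.div_apply]
  rw [tsum_congr (heq z hz hne'), tsum_mul_left, mul_div_cancel_left₀ _ hp]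
  rfl

/-- For every multi-index `α = (α₁,…,α_s)`: the multiple series
defining `G_α(z)` converges (is summable) for every `z` which is not a negative
integer; `G_α` is holomorphic on `ℂ ∖ {-1,-2,…}`; it extends to a meromorphic
function on `ℂ` with poles contained in `{-α_s, -α_s-1, -α_s-2, …}`; and
`G_α(0) = 0`. -/
theorem Gfun_analytic_properties (α : List ℕ) (hα : MIdx α) :
    (∀ z : ℂ, (∀ m : ℕ, z ≠ -((m : ℂ) + 1)) → Summable (Gterm α z)) ∧
    DifferentiableOn ℂ (Gfun α) {z : ℂ | ∀ m : ℕ, z ≠ -((m : ℂ) + 1)} ∧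
    (∃ h : ℂ → ℂ, MeromorphicOn h Set.univ ∧
      (∀ z : ℂ, (∀ m : ℕ, z ≠ -((m : ℂ) + 1)) → h z = Gfun α z) ∧
      (∀ z : ℂ, (∀ m : ℕ, z ≠ -((α.getLastD 0 : ℂ)) - (m : ℂ)) → AnalyticAt ℂ h z)) ∧
    Gfun α 0 = 0 := by
  have hlast : 1 ≤ α.getLastD 0 := by
    rcases List.eq_nil_or_concat α with rfl | ⟨β, L, rfl⟩
    · exact absurd rfl hα.1
    · have := hα.2 L (by simp)
      simpa using this
  have hm : 0 < α.sum := lt_of_lt_of_le hlast (getLastD_le_sum α)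
  have hgood : ∀ z : ℂ, (∀ m : ℕ, z ≠ -((m : ℂ) + 1)) →
      ∀ n : ℕ, 0 < n → α.getLastD 0 ≤ n → (n : ℂ) + z ≠ 0 := by
    intro z hz n hn _ h
    apply hz (n - 1)
    rw [Nat.cast_sub hn]
    push_cast
    linear_combination h
  refine ⟨fun z hz => (G_good α hm z (hgood z hz)).1, fun z hz =>
    (G_good α hm z (hgood z hz)).2.differentiableAt.differentiableWithinAt,
    ⟨Gfun α, fun z _ => G_mero α hm z, fun _ _ => rfl, ?_⟩, ?_⟩
  · intro z hz
    refine (G_good α hm z ?_).2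
    intro n _ hL h
    apply hz (n - α.getLastD 0)
    rw [Nat.cast_sub hL]
    linear_combination h
  · unfold Gfun
    have : ∀ v, Gterm α 0 v = 0 := by
      intro v
      unfold Gterm
      split_ifs
      · exact Finset.prod_eq_zero (Finset.mem_univ ⟨0, hm⟩) (by simp)
      · rfl
    simp [this]
end

section
/- Let p ≥ 1 be an integer, n ∈ ℕ, and let γ_1 ≥ 2 and γ_2,…,γ_p, γ'_1,…,γ'_p ≥ 1 be integers. Then Φ_{n+1}[all □_i = >, all □'_i = ≥; (γ_1,…,γ_p); (γ'_1,…,γ'_p)] − Φ_{n+1}[all □_i = ≥, all □'_i = >; (γ_1,…,γ_p); (γ'_1,…,γ'_p)] = (1/(n+1))·( Φ_{n+1}[all □_i = >, all □'_i = ≥; (γ_1−1,γ_2,…,γ_p); (γ'_1,…,γ'_p)] − Φ_{n+1}[all □_i = ≥, all □'_i = >; (γ_1,…,γ_p); (γ'_1,…,γ'_{p−1},γ'_p−1)] ). -/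
open scoped BigOperators

namespace PhiAux

noncomputable def wt (N : ℝ) (ty : ℕ) (x : ℕ) : ℝ :=
  if ty = 0 then (1 / (x : ℝ) - 1 / ((x : ℝ) + N))
  else if ty = 1 then 1 / ((x : ℝ) + N) else 1 / (x : ℝ)

def rng (b : Bool) (k : ℕ) : Finset ℕ := if b then Finset.Icc 1 k else Finset.Ico 1 k

lemma mem_rng (b : Bool) (k m : ℕ) :
    m ∈ rng b k ↔ 0 < m ∧ (if b then m ≤ k else m < k) := by
  cases b <;> simp [rng, Nat.succ_le_iff]

noncomputable def gS (N : ℝ) : List (ℕ × Bool) → ℕ → ℝ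
  | [], _ => 1
  | a :: w, k => ∑ m ∈ rng a.2 k, wt N a.1 m * gS N w m

noncomputable def Rt (N : ℝ) : (w : List (ℕ × Bool)) → ℕ → (Fin w.length → ℕ) → ℝ
  | [], _, _ => 1
  | a :: w, k, v => if v (0 : Fin (w.length + 1)) ∈ rng a.2 k then
      wt N a.1 (v (0 : Fin (w.length + 1))) *
        Rt N w (v (0 : Fin (w.length + 1))) (fun j => v (Fin.succ j)) else 0

open Classical in
noncomputable def Pt (N : ℝ) (w : List (ℕ × Bool)) (v : Fin w.length → ℕ) : ℝ :=
  if (∀ j, 0 < v j) ∧ (∀ j k : Fin w.length, (k : ℕ) = (j : ℕ) + 1 →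
          (if (w.get k).2 then v k ≤ v j else v k < v j))
    then ∏ j : Fin w.length, wt N (w.get j).1 (v j)
    else 0

lemma PhiSum_eq (w : List (ℕ × Bool)) (N : ℝ) :
    PhiSum w (N : ℂ) = ((∑' v, Pt N w v : ℝ) : ℂ) := by
  rw [PhiSum, Complex.ofReal_tsum]
  congr 1
  ext v
  unfold Pt
  split_ifs with h
  · rw [Complex.ofReal_prod]
    refine Finset.prod_congr rfl fun j _ => ?_
    unfold wt
    split_ifs <;> push_cast <;> rfl
  · simp

lemma chain_cons (a a' : ℕ × Bool) (w : List (ℕ × Bool)) (v : Fin (w.length + 2) → ℕ) :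
    ((∀ j, 0 < v j) ∧ (∀ j k : Fin (w.length + 2), (k : ℕ) = (j : ℕ) + 1 →
          (if ((a :: a' :: w).get k).2 then v k ≤ v j else v k < v j))) ↔
    (0 < v 0 ∧ (if a'.2 then v 1 ≤ v 0 else v 1 < v 0)) ∧
    ((∀ j : Fin (w.length + 1), 0 < v j.succ) ∧
      (∀ j k : Fin (w.length + 1), (k : ℕ) = (j : ℕ) + 1 →
          (if ((a' :: w).get k).2 then v k.succ ≤ v j.succ else v k.succ < v j.succ))) := by
  constructor
  · rintro ⟨h1, h2⟩
    refine ⟨⟨h1 0, ?_⟩, fun j => h1 _, fun j k hjk => ?_⟩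
    · exact h2 0 1 (by simp)
    · exact h2 j.succ k.succ (by simp [hjk])
  · rintro ⟨⟨h1, h2⟩, h3, h4⟩
    refine ⟨fun j => ?_, fun j k hjk => ?_⟩
    · refine Fin.cases h1 h3 j
    · obtain ⟨k', rfl⟩ : ∃ k', k = Fin.succ k' := by
        refine Fin.exists_succ_eq.2 ?_ |>.imp fun _ h => h.symm
        rintro rfl
        simp at hjk
      induction j using Fin.cases with
      | zero =>
        have : k' = 0 := by
          apply Fin.ext
          simpa using hjk
        subst this
        exact h2
      | succ j' => exact h4 j' k' (by simpa using hjk)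

lemma Pt_cons (N : ℝ) (w : List (ℕ × Bool)) : ∀ (a : ℕ × Bool) (v : Fin (w.length + 1) → ℕ),
    Pt N (a :: w) v = if 0 < v 0 then wt N a.1 (v 0) * Rt N w (v 0) (fun j => v j.succ) else 0 := by
  induction w with
  | nil =>
    intro a v
    unfold Pt
    have : (∀ j : Fin 1, 0 < v j) ∧ (∀ j k : Fin 1, (k : ℕ) = (j : ℕ) + 1 →
          (if (([a] : List (ℕ × Bool)).get k).2 then v k ≤ v j else v k < v j)) ↔ 0 < v 0 := by
      constructor
      · exact fun h => h.1 0
      · refine fun h => ⟨fun j => by rwa [Subsingleton.elim j 0], fun j k hjk => ?_⟩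
        have := k.2
        omega
    refine (if_congr this ?_ rfl)
    simp only [Rt, mul_one]
    exact Fin.prod_univ_one _
  | cons a' w ih =>
    intro a v
    have ih' := ih a' (fun j => v j.succ)
    unfold Pt at ih' ⊢
    have key := chain_cons a a' w v
    by_cases h0 : 0 < v 0 ∧ (if a'.2 then v 1 ≤ v 0 else v 1 < v 0)
    · rw [if_pos h0.1]
      refine (if_congr (key.trans (and_iff_right h0)) rfl rfl).trans ?_
      have hR : Rt N (a' :: w) (v 0) (fun j => v j.succ) =
          if 0 < v 1 then wt N a'.1 (v 1) * Rt N w (v 1) (fun j => v j.succ.succ) else 0 := by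
        rw [Rt]
        refine if_congr ?_ rfl rfl
        rw [mem_rng]
        exact and_iff_left h0.2
      rw [hR]
      rw [show (if 0 < v 1 then wt N a'.1 (v 1) * Rt N w (v 1) (fun j => v j.succ.succ) else 0) =
        _ from ih'.symm]
      rw [mul_ite, mul_zero]
      refine if_congr Iff.rfl ?_ rfl
      exact Fin.prod_univ_succ _
    · refine (if_neg (fun h => h0 (key.1 h).1)).trans ?_
      split_ifs with h1
      · rw [Rt, if_neg, mul_zero]
        rw [mem_rng]
        rintro ⟨_, h⟩
        exact h0 ⟨h1, h⟩
      · rfl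

lemma hasSum_Rt (N : ℝ) (w : List (ℕ × Bool)) : ∀ k, HasSum (Rt N w k) (gS N w k) := by
  induction w with
  | nil =>
    intro k
    have : Rt N [] k = fun _ => 1 := by ext v; rfl
    rw [this]
    simp only [gS]
    exact hasSum_unique (fun _ : Fin 0 → ℕ => (1 : ℝ))
  | cons a w ih =>
    intro k
    let e : ℕ × (Fin w.length → ℕ) ≃ (Fin (w.length + 1) → ℕ) := Fin.consEquiv (fun _ => ℕ)
    refine (Equiv.hasSum_iff e).1 ?_
    have h1 : ∀ m0 ∈ rng a.2 k, HasSum (fun p : ℕ × (Fin w.length → ℕ) =>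
        if p.1 = m0 then wt N a.1 m0 * Rt N w m0 p.2 else 0) (wt N a.1 m0 * gS N w m0) := by
      intro m0 _
      have hinj : Function.Injective (fun v : Fin w.length → ℕ => (m0, v)) :=
        fun _ _ h => (Prod.ext_iff.1 h).2
      refine (hinj.hasSum_iff ?_).1 ?_
      · rintro ⟨m, v⟩ h
        rw [if_neg]
        rintro rfl
        exact h ⟨v, rfl⟩
      · simpa [Function.comp_def] using (ih m0).mul_left (wt N a.1 m0)
    have h2 := hasSum_sum h1
    rw [gS]
    convert h2 using 1
    ext ⟨m, v⟩
    rw [Finset.sum_ite_eq]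
    rfl

lemma wt_nonneg {N : ℝ} (hN : 0 < N) (ty m : ℕ) (hm : 0 < m) : 0 ≤ wt N ty m := by
  have hm' : (0 : ℝ) < m := by exact_mod_cast hm
  unfold wt
  split_ifs
  · rw [sub_nonneg]
    exact one_div_le_one_div_of_le hm' (by linarith)
  · positivity
  · positivity

lemma wt_le {N : ℝ} (hN : 0 < N) (ty m : ℕ) (hm : 0 < m) : wt N ty m ≤ 1 / m := by
  have hm' : (0 : ℝ) < m := by exact_mod_cast hm
  unfold wt
  split_ifs
  · have : 0 ≤ 1 / ((m : ℝ) + N) := by positivity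
    linarith
  · exact one_div_le_one_div_of_le hm' (by linarith)
  · exact le_rfl

lemma Rt_nonneg {N : ℝ} (hN : 0 < N) (w : List (ℕ × Bool)) : ∀ k v, 0 ≤ Rt N w k v := by
  induction w with
  | nil => intro k v; simp [Rt]
  | cons a w ih =>
    intro k v
    rw [Rt]
    split_ifs with h
    · exact mul_nonneg (wt_nonneg hN _ _ ((mem_rng _ _ _).1 h).1) (ih _ _)
    · exact le_rfl

lemma gS_nonneg {N : ℝ} (hN : 0 < N) (w : List (ℕ × Bool)) (k : ℕ) : 0 ≤ gS N w k :=
  (hasSum_Rt N w k).nonneg (Rt_nonneg hN w k)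

lemma harm_mono {m k : ℕ} (h : m ≤ k) : (harmonic m : ℝ) ≤ harmonic k := by
  have : harmonic m ≤ harmonic k := by
    unfold harmonic
    apply Finset.sum_le_sum_of_subset_of_nonneg
    · exact Finset.range_mono h
    · intros; positivity
  exact_mod_cast this

lemma harm_nonneg (k : ℕ) : (0 : ℝ) ≤ harmonic k := by
  have := harm_mono (Nat.zero_le k)
  simpa using this

lemma gS_le {N : ℝ} (hN : 0 < N) (w : List (ℕ × Bool)) : ∀ k,
    gS N w k ≤ (harmonic k : ℝ) ^ w.length := by
  induction w with
  | nil => intro k; simp [gS]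
  | cons a w ih =>
    intro k
    rw [gS]
    have hsub : rng a.2 k ⊆ Finset.Icc 1 k := by
      intro m hm
      rw [mem_rng] at hm
      rw [Finset.mem_Icc]
      refine ⟨hm.1, ?_⟩
      have := hm.2
      split_ifs at this <;> omega
    calc ∑ m ∈ rng a.2 k, wt N a.1 m * gS N w m
        ≤ ∑ m ∈ rng a.2 k, (m : ℝ)⁻¹ * (harmonic k : ℝ) ^ w.length := by
          refine Finset.sum_le_sum fun m hm => ?_
          have h0 := ((mem_rng _ _ _).1 hm).1
          have hk := (Finset.mem_Icc.1 (hsub hm)).2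
          refine mul_le_mul ?_ ?_ (gS_nonneg hN _ _) (by positivity)
          · have := wt_le hN a.1 m h0
            rwa [one_div] at this
          · exact (ih m).trans (pow_le_pow_left₀ (harm_nonneg m) (harm_mono hk) _)
      _ ≤ ∑ m ∈ Finset.Icc 1 k, (m : ℝ)⁻¹ * (harmonic k : ℝ) ^ w.length := by
          refine Finset.sum_le_sum_of_subset_of_nonneg hsub fun m _ _ => ?_
          have := harm_nonneg k
          positivity
      _ = (harmonic k : ℝ) ^ (a :: w).length := by
          rw [← Finset.sum_mul, List.length_cons, pow_succ', harmonic_eq_sum_Icc]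
          push_cast
          rfl

lemma harm_bound (L k : ℕ) (hk : 0 < k) :
    (harmonic k : ℝ) ^ L ≤ (2 * L + 3) ^ L * (k : ℝ) ^ (1 / 2 : ℝ) := by
  have hk1 : (1 : ℝ) ≤ k := by exact_mod_cast hk
  set ε : ℝ := 1 / (2 * L + 2) with hε
  have hε0 : 0 < ε := by positivity
  have h1 : (harmonic k : ℝ) ≤ (2 * L + 3) * (k : ℝ) ^ ε := by
    have a1 := harmonic_le_one_add_log k
    have a2 := Real.log_le_rpow_div (x := (k : ℝ)) (by positivity) hε0
    have a3 : (1 : ℝ) ≤ (k : ℝ) ^ ε := Real.one_le_rpow hk1 hε0.le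
    have a4 : (k : ℝ) ^ ε / ε = (2 * L + 2) * (k : ℝ) ^ ε := by
      rw [hε]; field_simp
    rw [a4] at a2
    linarith
  calc (harmonic k : ℝ) ^ L ≤ ((2 * L + 3) * (k : ℝ) ^ ε) ^ L :=
        pow_le_pow_left₀ (harm_nonneg k) h1 _
    _ = (2 * L + 3) ^ L * (k : ℝ) ^ (ε * L) := by
        rw [mul_pow, ← Real.rpow_natCast ((k : ℝ) ^ ε), ← Real.rpow_mul (by positivity)]
    _ ≤ _ := by
        refine mul_le_mul_of_nonneg_left ?_ (by positivity)
        refine Real.rpow_le_rpow_of_exponent_le hk1 ?_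
        rw [hε, div_mul_eq_mul_div, one_mul, div_le_div_iff₀ (by positivity) (by norm_num)]
        linarith

noncomputable def oterm (N : ℝ) (w : List (ℕ × Bool)) (k : ℕ) : ℝ :=
  if 0 < k then wt N 0 k * gS N w k else 0

lemma summable_oterm {N : ℝ} (hN : 0 < N) (w : List (ℕ × Bool)) : Summable (oterm N w) := by
  have hs : Summable (fun k : ℕ => (N * (2 * w.length + 3) ^ w.length) * (1 / (k : ℝ) ^ (3 / 2 : ℝ))) :=
    (Real.summable_one_div_nat_rpow.2 (by norm_num)).mul_left _
  refine Summable.of_nonneg_of_le (fun k => ?_) (fun k => ?_) hs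
  · unfold oterm
    split_ifs with h
    · exact mul_nonneg (wt_nonneg hN _ _ h) (gS_nonneg hN _ _)
    · exact le_rfl
  · unfold oterm
    split_ifs with h
    · have hk : (0 : ℝ) < k := by exact_mod_cast h
      have h1 : wt N 0 k ≤ N * (1 / (k : ℝ) ^ 2) := by
        simp only [wt, if_true]
        rw [div_sub_div _ _ hk.ne' (by positivity), mul_one_div, div_le_div_iff₀ (by positivity) (by positivity)]
        nlinarith [mul_pos hk hN, mul_pos (mul_pos hk hN) hN]
      have h2 := (gS_le hN w k).trans (harm_bound w.length k h)
      refine (mul_le_mul h1 h2 (gS_nonneg hN _ _) (by positivity)).trans (le_of_eq ?_)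
      have : (k : ℝ) ^ 2 = (k : ℝ) ^ (3 / 2 : ℝ) * (k : ℝ) ^ (1 / 2 : ℝ) := by
        rw [← Real.rpow_add hk, ← Real.rpow_natCast]
        norm_num
      rw [this]
      have : (k : ℝ) ^ (1 / 2 : ℝ) ≠ 0 := by positivity
      field_simp
    · positivity

lemma tsum_Pt {N : ℝ} (hN : 0 < N) (b : Bool) (w : List (ℕ × Bool)) :
    ∑' v, Pt N ((0, b) :: w) v = ∑' k, oterm N w k := by
  let e : ℕ × (Fin w.length → ℕ) ≃ (Fin (w.length + 1) → ℕ) := Fin.consEquiv (fun _ => ℕ)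
  have h1 : ∑' v, Pt N ((0, b) :: w) v =
      ∑' p : ℕ × (Fin w.length → ℕ), (if 0 < p.1 then wt N 0 p.1 * Rt N w p.1 p.2 else 0) := by
    refine (e.tsum_eq _).symm.trans ?_
    refine tsum_congr fun p => ?_
    exact Pt_cons N w (0, b) (e p)
  rw [h1]
  have h2 : ∀ k, HasSum (fun v : Fin w.length → ℕ => if 0 < k then wt N 0 k * Rt N w k v else 0)
      (oterm N w k) := by
    intro k
    unfold oterm
    split_ifs
    · exact (hasSum_Rt N w k).mul_left _
    · exact hasSum_zero
  have h3 : Summable (fun p : ℕ × (Fin w.length → ℕ) =>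
      (if 0 < p.1 then wt N 0 p.1 * Rt N w p.1 p.2 else 0)) := by
    refine (summable_prod_of_nonneg ?_).2 ⟨fun k => (h2 k).summable, ?_⟩
    · intro p
      dsimp
      split_ifs with h
      · exact mul_nonneg (wt_nonneg hN _ _ h) (Rt_nonneg hN _ _ _)
      · exact le_rfl
    · simp only [fun k => (h2 k).tsum_eq]
      exact summable_oterm hN w
  rw [h3.tsum_prod]
  exact tsum_congr fun k => (h2 k).tsum_eq

def tyc (t : Bool) : ℕ := if t then 1 else 2

def wA : Bool → List Bool → List (ℕ × Bool)
  | _, [] => []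
  | s, t :: r => (tyc t, s) :: wA t r

def wB (t : List Bool) : List (ℕ × Bool) := t.map fun s => (tyc s, s)

lemma rng_true (k : ℕ) (hk : 0 < k) : rng true k = insert k (rng false k) := by
  ext m
  simp [rng]
  omega

lemma not_mem_rng_false (k : ℕ) : k ∉ rng false k := by simp [rng]

lemma merge {N : ℝ} (hN : 0 < N) (s t : Bool) (m : ℕ) (hm : 0 < m) (F : ℕ → ℝ) :
    wt N (tyc s) m * (∑ l ∈ rng s m, wt N (tyc t) l * F l - ∑ l ∈ rng t m, wt N (tyc t) l * F l) =
    1 / N * ((wt N (tyc t) m - wt N (tyc s) m) * F m) := by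
  have hm' : (0 : ℝ) < m := by exact_mod_cast hm
  cases s <;> cases t <;>
    simp only [sub_self, mul_zero, zero_mul, rng_true m hm,
      Finset.sum_insert (not_mem_rng_false m)] <;>
    simp [wt, tyc] <;> field_simp <;> ring

lemma telescoping {N : ℝ} (hN : 0 < N) (t : List Bool) : ∀ (s : Bool) (k : ℕ),
    ∑ m ∈ rng s k, wt N (tyc s) m * (gS N (wA s t) m - gS N (wB t) m) =
      1 / N * (gS N (wA s t) k - gS N (wB ((s :: t).dropLast)) k) := by
  induction t with
  | nil => intro s k; simp [wA, wB, gS]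
  | cons t r ih =>
    intro s k
    have hA : ∀ k, gS N (wA s (t :: r)) k =
      ∑ m ∈ rng s k, wt N (tyc t) m * gS N (wA t r) m := fun k => rfl
    have hB : ∀ k, gS N (wB (t :: r)) k =
      ∑ m ∈ rng t k, wt N (tyc t) m * gS N (wB r) m := fun k => rfl
    have hD : gS N (wB ((s :: t :: r).dropLast)) k =
      ∑ m ∈ rng s k, wt N (tyc s) m * gS N (wB ((t :: r).dropLast)) m := rfl
    rw [hD, hA k, ← Finset.sum_sub_distrib, Finset.mul_sum]
    refine Finset.sum_congr rfl fun m hm => ?_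
    have h1 := merge hN s t m ((mem_rng _ _ _).1 hm).1 (gS N (wA t r))
    have h2 := ih t m
    simp only [mul_sub, Finset.sum_sub_distrib] at h2
    rw [hA m, hB m]
    linear_combination h1 + wt N (tyc s) m * h2

lemma main_real {N : ℝ} (hN : 0 < N) (t : List Bool) :
    ∑' k, oterm N (wA true (true :: t)) k - ∑' k, oterm N (wB (true :: t)) k =
    1 / N * (∑' k, oterm N (wA true t) k - ∑' k, oterm N (wB ((true :: t).dropLast)) k) := by
  rw [← (summable_oterm hN _).tsum_sub (summable_oterm hN _),
    ← (summable_oterm hN _).tsum_sub (summable_oterm hN _), ← tsum_mul_left]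
  refine tsum_congr fun k => ?_
  unfold oterm
  split_ifs with h
  · have h1 := telescoping hN t true k
    simp only [mul_sub, Finset.sum_sub_distrib] at h1
    have hA : gS N (wA true (true :: t)) k =
      ∑ m ∈ rng true k, wt N (tyc true) m * gS N (wA true t) m := rfl
    have hB : gS N (wB (true :: t)) k =
      ∑ m ∈ rng true k, wt N (tyc true) m * gS N (wB t) m := rfl
    rw [hA, hB]
    linear_combination wt N 0 k * h1
  · simp

def tl (gs : List (ℕ × ℕ)) : List Bool :=
  gs.flatMap fun g => List.replicate g.1 true ++ List.replicate g.2 false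

lemma blockPart_rep (ty : ℕ) (m : ℕ) : blockPart ty (ty == 1) m = List.replicate m (ty, ty == 1) := by
  cases m <;> simp [blockPart, List.replicate_succ]

lemma mkWord_B (gs : List (ℕ × ℕ)) : mkWord false true gs = wB (tl gs) := by
  induction gs with
  | nil => rfl
  | cons g gs ih =>
    have h1 := blockPart_rep 1 g.1
    have h2 := blockPart_rep 2 g.2
    simp only [mkWord, wB, tl, List.flatMap_cons, List.map_append, List.map_replicate] at ih ⊢
    rw [ih]
    congr 1
    simpa [tyc] using congrArg₂ (· ++ ·) h1 h2

lemma wA_rep (s : Bool) (m : ℕ) (r : List Bool) :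
    wA s (List.replicate m s ++ r) = List.replicate m (tyc s, s) ++ wA s r := by
  induction m with
  | zero => simp
  | succ m ih => simp [List.replicate_succ, wA, ih]

lemma mkWord_A (gs : List (ℕ × ℕ)) (h : ∀ g ∈ gs, 1 ≤ g.1 ∧ 1 ≤ g.2) :
    mkWord true false gs = wA false (tl gs) := by
  induction gs with
  | nil => rfl
  | cons g gs ih =>
    obtain ⟨a, b⟩ := g
    have ih' := ih fun g hg => h g (List.mem_cons_of_mem _ hg)
    obtain ⟨h1, h2⟩ := h (a, b) List.mem_cons_self
    obtain ⟨a, rfl⟩ : ∃ a', a = a' + 1 := ⟨a - 1, by simp at h1; omega⟩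
    obtain ⟨b, rfl⟩ : ∃ a', b = a' + 1 := ⟨b - 1, by simp at h2; omega⟩
    simp only [mkWord, tl, List.flatMap_cons] at ih' ⊢
    rw [ih']
    simp [blockPart, List.replicate_succ, wA, wA_rep, tyc]

lemma tl_dropLast (γ γ' : List ℕ) (hl : γ.length = γ'.length) (hne : γ' ≠ []) (hγ' : ∀ x ∈ γ', 1 ≤ x) :
    tl (γ.zip (γ'.dropLast ++ [γ'.getLastD 0 - 1])) = (tl (γ.zip γ')).dropLast := by
  induction γ generalizing γ' with
  | nil => cases γ' <;> simp_all
  | cons a γ ih =>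
    cases γ' with
    | nil => simp at hne
    | cons b γ' =>
      cases γ' with
      | nil =>
        have hb := hγ' b (by simp)
        obtain ⟨b, rfl⟩ : ∃ a', b = a' + 1 := ⟨b - 1, by omega⟩
        have : γ = [] := by simpa using hl
        subst this
        simp only [List.dropLast_singleton, List.nil_append, List.getLastD_cons, List.getLastD_nil, tl,
          List.zip_cons_cons, List.zip_nil_right, List.flatMap_cons, List.flatMap_nil, List.append_nil,
          Nat.add_sub_cancel]
        rw [List.replicate_succ', ← List.append_assoc, List.dropLast_concat]
      | cons c γ' =>
        have ih' := ih (c :: γ') (by simpa using hl) (by simp) (fun x hx => hγ' x (List.mem_cons_of_mem _ hx))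
        have hne2 : tl (γ.zip (c :: γ')) ≠ [] := by
          cases γ with
          | nil => simp at hl
          | cons d γ =>
            have := hγ' c (by simp)
            simp [tl]
            omega
        simp only [tl, List.dropLast_cons_cons, List.cons_append, List.zip_cons_cons, List.flatMap_cons,
          List.getLastD_cons] at ih' hne2 ⊢
        rw [ih', List.dropLast_append_of_ne_nil hne2]

end PhiAux

/-- (Lemma 2.5 of the paper.) For `γ₁ ≥ 2` and
`γ₂,…,γ_p,γ'₁,…,γ'_p ≥ 1`,
`Φ_{n+1}[>,≥;γ;γ'] - Φ_{n+1}[≥,>;γ;γ']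
  = (1/(n+1))(Φ_{n+1}[>,≥;(γ₁-1,γ₂,…);γ'] - Φ_{n+1}[≥,>;γ;(γ'₁,…,γ'_p-1)])`,
where `[>,≥]` means all `□_i` are `>` and all `□'_i` are `≥`, and `[≥,>]` the
opposite. -/
theorem phi_difference_identity (p : ℕ) (hp : 1 ≤ p) (n : ℕ) (γ γ' : List ℕ)
    (hγl : γ.length = p) (hγ'l : γ'.length = p)
    (hγ1 : 2 ≤ γ.headI) (hγ : ∀ x ∈ γ, 1 ≤ x) (hγ' : ∀ x ∈ γ', 1 ≤ x) :
    PhiSum (phiWord true false (γ.zip γ')) ((n : ℂ) + 1) -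
      PhiSum (phiWord false true (γ.zip γ')) ((n : ℂ) + 1) =
    (1 / ((n : ℂ) + 1)) *
      (PhiSum (phiWord true false (((γ.headI - 1) :: γ.tail).zip γ')) ((n : ℂ) + 1) -
        PhiSum (phiWord false true
          (γ.zip (γ'.dropLast ++ [γ'.getLastD 0 - 1]))) ((n : ℂ) + 1)) := by
  obtain ⟨a, γ, rfl⟩ : ∃ a l, γ = a :: l := by
    cases γ with
    | nil => simp at hγ1
    | cons a l => exact ⟨a, l, rfl⟩
  obtain ⟨b, γ', rfl⟩ : ∃ a l, γ' = a :: l := by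
    cases γ' with
    | nil => simp at hγ'l; omega
    | cons a l => exact ⟨a, l, rfl⟩
  simp only [List.headI_cons] at hγ1
  obtain ⟨a, rfl⟩ : ∃ a', a = a' + 2 := ⟨a - 2, by omega⟩
  have hall : ∀ (x : ℕ) (_ : 1 ≤ x), ∀ g ∈ (x :: γ).zip (b :: γ'), 1 ≤ g.1 ∧ 1 ≤ g.2 := by
    rintro x hx ⟨g1, g2⟩ hg
    have h := List.of_mem_zip hg
    refine ⟨?_, hγ' _ h.2⟩
    rcases List.mem_cons.1 h.1 with h | h
    · simpa [h] using hx
    · exact hγ _ (List.mem_cons_of_mem _ h)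
  have hN : (0 : ℝ) < (n : ℝ) + 1 := by positivity
  obtain ⟨t, ht, ht'⟩ : ∃ t, PhiAux.tl (((a + 2) :: γ).zip (b :: γ')) = true :: true :: t ∧
      PhiAux.tl (((a + 1) :: γ).zip (b :: γ')) = true :: t :=
    ⟨List.replicate a true ++ (List.replicate b false ++ PhiAux.tl (γ.zip γ')), by
      simp [PhiAux.tl, List.replicate_succ], by simp [PhiAux.tl, List.replicate_succ]⟩
  have e1 : phiWord true false (((a + 2) :: γ).zip (b :: γ')) =
      (0, false) :: PhiAux.wA true (true :: t) := by
    unfold phiWord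
    rw [PhiAux.mkWord_A _ (hall _ (by omega)), ht]
    rfl
  have e2 : phiWord false true (((a + 2) :: γ).zip (b :: γ')) =
      (0, true) :: PhiAux.wB (true :: t) := by
    unfold phiWord
    rw [PhiAux.mkWord_B, ht]
    rfl
  have e3 : phiWord true false (((a + 1) :: γ).zip (b :: γ')) =
      (0, false) :: PhiAux.wA true t := by
    unfold phiWord
    rw [PhiAux.mkWord_A _ (hall _ (by omega)), ht']
    rfl
  have e4 : phiWord false true
      (((a + 2) :: γ).zip ((b :: γ').dropLast ++ [(b :: γ').getLastD 0 - 1])) =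
      (0, true) :: PhiAux.wB ((true :: t).dropLast) := by
    unfold phiWord
    rw [PhiAux.mkWord_B, PhiAux.tl_dropLast _ _ (hγl.trans hγ'l.symm) (by simp) hγ', ht]
    rfl
  have e5 : ((((a + 2) :: γ).headI - 1) :: ((a + 2) :: γ).tail) = (a + 1) :: γ := rfl
  rw [e5, e1, e2, e3, e4]
  have hc : ((n : ℂ) + 1) = (((n : ℝ) + 1 : ℝ) : ℂ) := by push_cast; rfl
  rw [hc]
  simp only [PhiAux.PhiSum_eq, PhiAux.tsum_Pt hN]
  exact_mod_cast PhiAux.main_real hN t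
end
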